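/- Let Σ₃ = {[[x,0],[0,0]] : x ∈ ℝ}, Σ₃⊥ = {[[0,v],[v,u]] : u,v ∈ ℝ}, and for γ ∈ ℝ let L_γ(σ₃) = {[[e^{γt},0],[s,e^{(γ+1)t}]] : s,t ∈ ℝ}, H_{γ,0}(σ₃) = {[[e^{γt},0],[0,e^{(γ+1)t}]] : t ∈ ℝ}, and H_∞(σ₃) = {e^t I₂ : t ∈ ℝ}. Then: (a) for every γ ≠ −1/2, there exists g ∈ Sp(2,ℝ) with g·(Σ₃⋊L_γ(σ₃))·g⁻¹ = Σ₃⊥⋊H_{−(γ+1)/(2γ+1),0}(σ₃); (b) there exists g ∈ Sp(2,ℝ) with g·(Σ₃⋊L_{−1/2}(σ₃))·g⁻¹ = Σ₃⊥⋊H_∞(σ₃). -/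

import Mathlib

open Matrix

noncomputable section

abbrev M2 := Matrix (Fin 2) (Fin 2) ℝ
abbrev M4 := Matrix (Fin 2 ⊕ Fin 2) (Fin 2 ⊕ Fin 2) ℝ

/-- The standard symplectic form `J = [[0, I₂], [-I₂, 0]]`. -/
def Jmat : M4 := fromBlocks 0 1 (-1) 0

/-- The symplectic group `Sp(2, ℝ)` as a set of `4 × 4` matrices. -/
def SpSet : Set M4 := {g | gᵀ * Jmat * g = Jmat}

/-- The block matrix `g(σ, h) = [[h, 0], [σh, ᵀh⁻¹]]`. -/
def gmat (σ h : M2) : M4 := fromBlocks h 0 (σ * h) h⁻¹ᵀ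

/-- The semidirect product set `Σ ⋊ H = {g(σ, h) : σ ∈ Σ, h ∈ H}`. -/
def sdp (S H : Set M2) : Set M4 := {g | ∃ σ ∈ S, ∃ h ∈ H, g = gmat σ h}

/-- Conjugation of a set of `4 × 4` matrices: `g·S·g⁻¹`. -/
def conj4 (g : M4) (S : Set M4) : Set M4 := (fun x => g * x * g⁻¹) '' S

/-- `Σ₃ = {[[x,0],[0,0]] : x ∈ ℝ}`. -/
def Sigma3 : Set M2 := {m | ∃ x : ℝ, m = !![x, 0; 0, 0]}

/-- `Σ₃⊥ = {[[0,v],[v,u]] : u, v ∈ ℝ}`. -/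
def Sigma3perp : Set M2 := {m | ∃ u v : ℝ, m = !![0, v; v, u]}

/-- `L_γ(σ₃) = {[[e^{γt},0],[s,e^{(γ+1)t}]] : s, t ∈ ℝ}`. -/
def Lgam (γ : ℝ) : Set M2 :=
  {m | ∃ s t : ℝ, m = !![Real.exp (γ * t), 0; s, Real.exp ((γ + 1) * t)]}

/-- `H_{γ,0}(σ₃) = {[[e^{γt},0],[0,e^{(γ+1)t}]] : t ∈ ℝ}`. -/
def Hgam (γ : ℝ) : Set M2 :=
  {m | ∃ t : ℝ, m = !![Real.exp (γ * t), 0; 0, Real.exp ((γ + 1) * t)]}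

/-- `H_∞(σ₃) = {e^t I₂ : t ∈ ℝ}`, the group of positive scalar matrices. -/
def Hinf : Set M2 := {m | ∃ t : ℝ, m = Real.exp t • (1 : M2)}

def Gm : M4 := fromBlocks !![0, 0; 1, 0] !![0, 1; 0, 0] !![0, -1; 0, 0] !![0, 0; 1, 0]

def GmI : M4 := fromBlocks !![0, 1; 0, 0] !![0, 0; -1, 0] !![0, 0; 1, 0] !![0, 1; 0, 0]

lemma Gm_mul : Gm * GmI = 1 := by
  rw [Gm, GmI, fromBlocks_multiply, ← fromBlocks_one]
  congr 1 <;> ext i j <;> fin_cases i <;> fin_cases j <;> simp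

lemma Gm_inv : Gm⁻¹ = GmI := Matrix.inv_eq_right_inv Gm_mul

lemma Gm_mem : Gm ∈ SpSet := by
  show Gmᵀ * Jmat * Gm = Jmat
  rw [Gm, Jmat, fromBlocks_transpose, fromBlocks_multiply, fromBlocks_multiply]
  congr 1 <;> ext i j <;> fin_cases i <;> fin_cases j <;>
    simp [Matrix.mul_apply, Fin.sum_univ_two]

lemma inv_low (a b s : ℝ) (ha : a ≠ 0) (hb : b ≠ 0) :
    (!![a, 0; s, b] : M2)⁻¹ = !![a⁻¹, 0; -s / (a * b), b⁻¹] := by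
  apply Matrix.inv_eq_right_inv
  ext i j
  fin_cases i <;> fin_cases j <;> simp [ha, hb]
  field_simp
  ring

lemma inv_lowT (a b s : ℝ) (ha : a ≠ 0) (hb : b ≠ 0) :
    (!![a, 0; s, b] : M2)⁻¹ᵀ = !![a⁻¹, -s / (a * b); 0, b⁻¹] := by
  rw [inv_low a b s ha hb]
  ext i j
  fin_cases i <;> fin_cases j <;> rfl

lemma key (a b s x : ℝ) (ha : a ≠ 0) (hb : b ≠ 0) :
    Gm * gmat !![x, 0; 0, 0] !![a, 0; s, b] * Gm⁻¹
      = gmat !![0, -s / a; -s / a, x] !![b⁻¹, 0; 0, a] := by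
  rw [Gm_inv, gmat, gmat, inv_lowT a b s ha hb, inv_lowT b⁻¹ a 0 (inv_ne_zero hb) ha, Gm, GmI,
    fromBlocks_multiply, fromBlocks_multiply]
  congr 1 <;> ext i j <;> fin_cases i <;> fin_cases j <;>
    simp [Matrix.mul_apply, Fin.sum_univ_two] <;> field_simp

lemma main_eq (γ : ℝ) (H : Set M2)
    (h1 : ∀ t : ℝ, !![(Real.exp ((γ + 1) * t))⁻¹, 0; 0, Real.exp (γ * t)] ∈ H)
    (h2 : ∀ m ∈ H, ∃ t : ℝ, m = !![(Real.exp ((γ + 1) * t))⁻¹, 0; 0, Real.exp (γ * t)]) :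
    conj4 Gm (sdp Sigma3 (Lgam γ)) = sdp Sigma3perp H := by
  ext y
  constructor
  · rintro ⟨_, ⟨_, ⟨x, rfl⟩, _, ⟨s, t, rfl⟩, rfl⟩, rfl⟩
    exact ⟨_, ⟨_, _, rfl⟩, _, h1 t, key _ _ s x (Real.exp_ne_zero _) (Real.exp_ne_zero _)⟩
  · rintro ⟨_, ⟨u, v, rfl⟩, h, hh, rfl⟩
    obtain ⟨t, rfl⟩ := h2 h hh
    refine ⟨_, ⟨_, ⟨u, rfl⟩, _, ⟨-v * Real.exp (γ * t), t, rfl⟩, rfl⟩, ?_⟩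
    have e : -(-v * Real.exp (γ * t)) / Real.exp (γ * t) = v := by
      field_simp
      try ring
    have k := key (Real.exp (γ * t)) (Real.exp ((γ + 1) * t)) (-v * Real.exp (γ * t)) u
      (Real.exp_ne_zero _) (Real.exp_ne_zero _)
    rw [e] at k
    exact k

theorem stmt18 :
    -- (a)
    (∀ γ : ℝ, γ ≠ -1/2 → ∃ g ∈ SpSet,
      conj4 g (sdp Sigma3 (Lgam γ)) = sdp Sigma3perp (Hgam (-(γ + 1) / (2 * γ + 1)))) ∧
    -- (b)
    (∃ g ∈ SpSet, conj4 g (sdp Sigma3 (Lgam (-1/2))) = sdp Sigma3perp Hinf) := by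
  refine ⟨fun γ hγ => ⟨Gm, Gm_mem, main_eq γ _ ?_ ?_⟩, ⟨Gm, Gm_mem, main_eq _ _ ?_ ?_⟩⟩
  · intro t
    have h0 : 2 * γ + 1 ≠ 0 := fun h => hγ (by linarith)
    have h0' : γ * 2 + 1 ≠ 0 := fun h => hγ (by linarith)
    refine ⟨(2 * γ + 1) * t, ?_⟩
    rw [← Real.exp_neg]
    have e1 : -(γ + 1) / (2 * γ + 1) * ((2 * γ + 1) * t) = -((γ + 1) * t) := by
      field_simp
    have e2 : (-(γ + 1) / (2 * γ + 1) + 1) * ((2 * γ + 1) * t) = γ * t := by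
      field_simp
      ring
    rw [e1, e2]
  · rintro _ ⟨t, rfl⟩
    have h0 : 2 * γ + 1 ≠ 0 := fun h => hγ (by linarith)
    have h0' : γ * 2 + 1 ≠ 0 := fun h => hγ (by linarith)
    refine ⟨t / (2 * γ + 1), ?_⟩
    rw [← Real.exp_neg]
    have e1 : -(γ + 1) / (2 * γ + 1) * t = -((γ + 1) * (t / (2 * γ + 1))) := by
      field_simp
    have e2 : (-(γ + 1) / (2 * γ + 1) + 1) * t = γ * (t / (2 * γ + 1)) := by
      field_simp
      ring
    rw [e1, e2]
  · intro t
    refine ⟨-1/2 * t, ?_⟩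
    rw [← Real.exp_neg, show -((-1/2 + 1) * t) = -1/2 * t by ring]
    ext i j
    fin_cases i <;> fin_cases j <;> simp
  · rintro _ ⟨t, rfl⟩
    refine ⟨-2 * t, ?_⟩
    rw [← Real.exp_neg, show -((-1/2 + 1) * (-2 * t)) = t by ring,
      show -1/2 * (-2 * t) = t by ring]
    ext i j
    fin_cases i <;> fin_cases j <;> simp
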